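/- Let f ∈ ℚ[x] be the polynomial f(x) = x^12 - 2x^11 - 9x^10 + 60x^8 + 42x^7 + 141x^6 + 162x^5 + 150x^4 + 60x^3 + 141x^2 + 18x + 21. Then the Galois group of f over ℚ is isomorphic to PSL₂(𝔽₁₁); in particular it has cardinality 660. -/

import Mathlib

open Polynomial

open scoped MatrixGroups

namespace ProjLine

/-- Whether `x - y` is a nonzero square modulo `11`. -/
def isSquareSub (x y : ℕ) : Bool := (x + (11 - y)) ^ 5 % 11 == 1

/-- The colour of the edge `x y` in a proper edge colouring by `11` colours of the complete graph on
the projective line `{0, …, 10, 11 = ∞}` over `ZMod 11`. -/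
def color (x y : ℕ) : ℕ :=
  bif x == 11 then y else bif y == 11 then x else
    bif isSquareSub y x then (2 * x + (11 - y)) % 11 else (2 * y + (11 - x)) % 11

/-- The point joined to `w` by an edge of colour `c`. -/
def partner (w c : ℕ) : ℕ :=
  bif w == 11 then c else bif w == c then 11 else
    bif isSquareSub w c then (2 * w + (11 - c)) % 11 else (6 * w + 6 * c) % 11

/-- The image of `x` under the Möbius transformation with matrix `!![a, b; c, d]`. -/
def mobius (a b c d x : ℕ) : ℕ :=
  bif x == 11 then bif c % 11 == 0 then 11 else a * c ^ 9 % 11 else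
    bif (c * x + d) % 11 == 0 then 11 else (a * x + b) * (c * x + d) ^ 9 % 11

/-- The first homogeneous coordinate of a point. -/
def fst (x : ℕ) : ℕ := bif x == 11 then 1 else x

/-- The second homogeneous coordinate of a point. -/
def snd (x : ℕ) : ℕ := bif x == 11 then 0 else 1

/-- The determinant, modulo `11`, of the homogeneous coordinates of two points. -/
def det (x y : ℕ) : ℕ := (fst x * snd y + (11 - fst y * snd x)) % 11

/-- The entries of a matrix which takes `∞, 0, 1` to `x, y, z`. Its determinant is a fifth power, so
it is `1` if it is a square. -/
def matrixOf (x y z : ℕ) : ℕ × ℕ × ℕ × ℕ :=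
  let l := det z y
  let m := det x z
  let e := (l * m * det x y) ^ 2 % 11
  (e * l * fst x % 11, e * m * fst y % 11, e * l * snd x % 11, e * m * snd y % 11)

/-- The values at `0, …, 10, 11` of a colour preserving permutation which takes `11, 0, 1` to
`x, y, z`, assuming that one exists. -/
def images (x y z : ℕ) : List ℕ :=
  let s₁₀ := partner x (color y z)
  let s₉ := partner x (color s₁₀ y)
  let s₈ := partner x (color s₉ s₁₀)
  let s₇ := partner x (color s₈ s₉)
  let s₆ := partner x (color s₇ s₈)
  let s₅ := partner x (color s₆ s₇)
  let s₄ := partner x (color s₅ s₆)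
  let s₃ := partner x (color s₄ s₅)
  let s₂ := partner x (color s₃ s₄)
  [y, z, s₂, s₃, s₄, s₅, s₆, s₇, s₈, s₉, s₁₀, x]

/-- If a colour preserving permutation takes `11, 0, 1` to `x, y, z`, then it is a Möbius
transformation of determinant `1`. -/
def check (x y z : ℕ) : Bool :=
  let M := matrixOf x y z
  x == y || x == z || y == z || !(partner y (color x z) == (images x y z).getD 6 0) ||
    ((M.1 * M.2.2.2) % 11 == (M.2.1 * M.2.2.1 + 1) % 11 &&
      images x y z == (List.range 12).map (mobius M.1 M.2.1 M.2.2.1 M.2.2.2))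

theorem partner_color : ∀ x y : Fin 12, x ≠ y → partner x (color x y) = y := by decide +kernel

theorem color_lt : ∀ x y : Fin 12, x ≠ y → color x y < 11 := by decide +kernel

theorem check_eq_true : ∀ x y z : Fin 12, check x y z = true := by decide +kernel

/-- A colour preserving permutation is a Möbius transformation of determinant `1`. -/
theorem exists_mobius {s : Fin 12 → Fin 12} (hs : s.Injective)
    (h : ∀ i j k l : Fin 12, i ≠ j → k ≠ l → color i j = color k l →
      color (s i) (s j) = color (s k) (s l)) :
    ∃ a b c d : ℕ, a * d % 11 = (b * c + 1) % 11 ∧ ∀ i, (s i : ℕ) = mobius a b c d i := by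
  have key (i j k l : Fin 12) (hij : i ≠ j := by decide) (hkl : k ≠ l := by decide)
      (hc : color i j = color k l := by decide) :
      partner (s i) (color (s k) (s l)) = s j := by
    rw [← h i j k l hij hkl hc, partner_color _ _ (hs.ne hij)]
  have himages : images (s 11) (s 0) (s 1) = (List.finRange 12).map fun i => (s i : ℕ) := by
    simp only [images, key 11 10 0 1, key 11 9 10 0, key 11 8 9 10, key 11 7 8 9, key 11 6 7 8,
      key 11 5 6 7, key 11 4 5 6, key 11 3 4 5, key 11 2 3 4]
    rfl
  have hcheck := check_eq_true (s 11) (s 0) (s 1)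
  have h₁ : s 11 ≠ s 0 := hs.ne (by decide)
  have h₂ : s 11 ≠ s 1 := hs.ne (by decide)
  have h₃ : s 0 ≠ s 1 := hs.ne (by decide)
  have h₄ : ((List.finRange 12).map fun i => (s i : ℕ)).getD 6 0 = s 6 := rfl
  rw [check, himages, key 0 6 11 1, h₄] at hcheck
  simp only [Bool.or_eq_true, beq_iff_eq, Fin.val_inj, h₁, h₂, h₃, false_or, BEq.rfl, Bool.not_true,
    Bool.false_eq_true, Bool.and_eq_true] at hcheck
  refine ⟨_, _, _, _, hcheck.1, fun i => ?_⟩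
  have := congrArg (fun l => l.getD i 0) hcheck.2
  simpa using this

open OnePoint Matrix

section Field

variable (K : Type*) [Field K] [DecidableEq K]

/-- The action of `SL(2, K)` on the projective line by Möbius transformations. -/
noncomputable def toPerm : SL(2, K) →* Equiv.Perm (OnePoint K) :=
  (MulAction.toPermHom (GL (Fin 2) K) (OnePoint K)).comp SpecialLinearGroup.toGL

variable {K}

theorem toPerm_infty (g : SL(2, K)) :
    toPerm K g ∞ = if g 1 0 = 0 then ∞ else ((g 0 0 / g 1 0 : K) : OnePoint K) :=
  smul_infty_eq_ite (g : GL (Fin 2) K)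

theorem toPerm_coe (g : SL(2, K)) (x : K) :
    toPerm K g x = if g 1 0 * x + g 1 1 = 0 then ∞ else
      (((g 0 0 * x + g 0 1) / (g 1 0 * x + g 1 1) : K) : OnePoint K) :=
  smul_some_eq_ite (g := (g : GL (Fin 2) K))

variable (K)

theorem ker_toPerm : (toPerm K).ker = Subgroup.center SL(2, K) := by
  ext g
  rw [MonoidHom.mem_ker, Matrix.SpecialLinearGroup.mem_center_iff]
  constructor
  · intro h
    have hdet := g.det_coe
    rw [det_fin_two] at hdet
    have h₁ := toPerm_infty g
    have h₂ := toPerm_coe g 0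
    have h₃ := toPerm_coe g 1
    simp only [h, Equiv.Perm.one_apply, mul_zero, mul_one, zero_add] at h₁ h₂ h₃
    split_ifs at h₁ with h₄
    · split_ifs at h₂ with h₅
      · simp at h₂
      split_ifs at h₃ with h₆
      · simp at h₃
      · rw [OnePoint.coe_eq_coe] at h₂ h₃
        rw [eq_div_iff h₅, zero_mul] at h₂
        rw [eq_div_iff h₆, one_mul] at h₃
        have h₇ : g 0 1 = 0 := h₂.symm
        have h₈ : g 0 0 = g 1 1 := by linear_combination h₄ - h₃ - h₇
        refine ⟨g 0 0, ?_, ?_⟩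
        · rw [Fintype.card_fin]
          linear_combination hdet + g 0 0 * h₈ + g 0 1 * h₄
        ext i j
        fin_cases i <;> fin_cases j <;> simp [h₄, h₇, h₈]
    · simp at h₁
  · rintro ⟨r, hr, hg⟩
    have hr0 : r ≠ 0 := by rintro rfl; simp at hr
    have h : ∀ i j, g i j = scalar (Fin 2) r i j := fun i j => by rw [hg]
    ext x
    induction x using OnePoint.rec with
    | infty => simp [toPerm_infty, h]
    | coe x => simp [toPerm_coe, h, hr0]

theorem natCard_range_toPerm_le [Finite K] (hK : (-1 : K) ≠ 1) :
    2 * Nat.card (toPerm K).range ≤ Nat.card K * (Nat.card K ^ 2 - 1) := by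
  have := Fintype.ofFinite K
  let q := Nat.card K
  have hq : q = Fintype.card K := Nat.card_eq_fintype_card
  have hq1 : 1 < q := hq ▸ Fintype.one_lt_card
  -- the order of `SL(2, K)`
  let det : GL (Fin 2) K →* Kˣ := GeneralLinearGroup.det
  have hdet : Function.Surjective det := fun u => by
    refine ⟨GeneralLinearGroup.mkOfDetNeZero !![(u : K), 0; 0, 1] (by simp), ?_⟩
    ext
    simp [det, GeneralLinearGroup.mkOfDetNeZero]
  have hker : Nat.card det.ker = Nat.card SL(2, K) := by
    refine (Nat.card_congr (Equiv.ofBijective (fun g : SL(2, K) => (⟨g, ?_⟩ : det.ker))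
      ⟨?_, ?_⟩)).symm
    · simp [det, MonoidHom.mem_ker]
    · intro g g' hg
      exact Matrix.SpecialLinearGroup.toGL_injective (congrArg Subtype.val hg)
    · rintro ⟨g, hg⟩
      exact ⟨⟨g, congrArg Units.val hg⟩, Subtype.ext (Units.ext rfl)⟩
  have hGL := Subgroup.card_eq_card_quotient_mul_card_subgroup det.ker
  rw [Nat.card_congr (QuotientGroup.quotientKerEquivOfSurjective det hdet).toEquiv, hker,
    card_GL_field, Fin.prod_univ_two, ← hq, Nat.card_units] at hGL
  have h2 := Subgroup.card_eq_card_quotient_mul_card_subgroup (toPerm K).ker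
  rw [Nat.card_congr (QuotientGroup.quotientKerEquivRange (toPerm K)).toEquiv] at h2
  have h3 : 2 ≤ Nat.card (toPerm K).ker := by
    rw [ker_toPerm]
    have : Nontrivial (Subgroup.center SL(2, K)) := by
      refine ⟨⟨⟨-1, ?_⟩, 1, fun h => ?_⟩⟩
      · rw [Subgroup.mem_center_iff]
        intro g
        rw [mul_neg, neg_mul, one_mul, mul_one]
      · refine hK ?_
        simpa using congrArg (fun g : Subgroup.center SL(2, K) => (g : SL(2, K)) 0 0) h
    exact Finite.one_lt_card
  obtain ⟨m, hm⟩ : ∃ m, m = q - 1 := ⟨_, rfl⟩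
  have hqm : q = m + 1 := by lia
  have hSL : Nat.card SL(2, K) = q * (q ^ 2 - 1) := by
    refine Nat.eq_of_mul_eq_mul_left (show 0 < m by lia) ?_
    have h4 : q ^ 2 - 1 = m ^ 2 + 2 * m := by
      rw [hqm]
      exact Nat.sub_eq_of_eq_add (by ring)
    have h5 : q ^ 2 - q = m ^ 2 + m := by
      rw [hqm]
      exact Nat.sub_eq_of_eq_add (by ring)
    have h6 : Nat.card K - 1 = m := hm.symm
    rw [h6] at hGL
    rw [← hGL, Fin.val_zero, Fin.val_one, pow_zero, pow_one, h4, h5, hqm]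
    ring
  change _ ≤ q * (q ^ 2 - 1)
  rw [← hSL, h2, mul_comm]
  gcongr

end Field

/-- The point of the projective line with the given label. -/
def point (x : ℕ) : OnePoint (ZMod 11) := if x = 11 then ∞ else ((x : ZMod 11) : OnePoint (ZMod 11))

theorem point_injective : Function.Injective fun i : Fin 12 => point i := by
  intro i j h
  simp only [point] at h
  split_ifs at h
  · exact Fin.ext (by lia)
  · simp at h
  · simp at h
  · rw [OnePoint.coe_eq_coe, ZMod.natCast_eq_natCast_iff'] at h
    exact Fin.ext (by lia)

theorem inv_eq_pow_nine [Fact (Nat.Prime 11)] (x : ZMod 11) : x⁻¹ = x ^ 9 := by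
  rcases eq_or_ne x 0 with rfl | hx
  · simp
  · rw [inv_eq_iff_eq_inv, ← mul_eq_one_iff_eq_inv₀ (pow_ne_zero _ hx), ← pow_succ']
    exact ZMod.pow_card_sub_one_eq_one hx

theorem exists_toPerm [Fact (Nat.Prime 11)] {a b c d : ℕ} (h : a * d % 11 = (b * c + 1) % 11) :
    ∃ M, ∀ x, toPerm (ZMod 11) M (point x) = point (mobius a b c d x) := by
  have hdet : (a * d : ZMod 11) = b * c + 1 := by
    exact_mod_cast (ZMod.natCast_eq_natCast_iff _ _ 11).2 h
  have hdvd (n : ℕ) : (n % 11 == 0) = decide ((n : ZMod 11) = 0) := by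
    rw [beq_eq_decide, decide_eq_decide, ZMod.natCast_eq_zero_iff, Nat.dvd_iff_mod_eq_zero]
  have hne (n : ℕ) : n % 11 ≠ 11 := (Nat.mod_lt _ (by norm_num)).ne
  let M : SL(2, ZMod 11) :=
    ⟨!![(a : ZMod 11), b; c, d], by rw [det_fin_two_of, hdet]; ring⟩
  have h₁ : toPerm (ZMod 11) M ∞ = if (c : ZMod 11) = 0 then ∞ else ((a / c : ZMod 11) : _) :=
    toPerm_infty M
  have h₂ (x : ZMod 11) : toPerm (ZMod 11) M x = if (c * x + d : ZMod 11) = 0 then ∞ else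
      (((a * x + b) / (c * x + d) : ZMod 11) : _) := toPerm_coe M x
  refine ⟨M, fun x => ?_⟩
  by_cases hx : x = 11
  · rw [point, if_pos hx, h₁]
    by_cases hc : (c : ZMod 11) = 0 <;>
      simp [point, mobius, hx, hdvd, hc, hne, div_eq_mul_inv, inv_eq_pow_nine]
  · rw [point, if_neg hx, h₂, ← Nat.cast_mul, ← Nat.cast_add, mobius, beq_false_of_ne hx,
      cond_false, hdvd]
    by_cases hc : ((c * x + d : ℕ) : ZMod 11) = 0
    · simp [hc, point]
    · simp only [hc, point, div_eq_mul_inv, inv_eq_pow_nine, if_false, decide_false,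
        cond_false, hne]
      simp

end ProjLine

open NumberField in
theorem natDegree_dvd_natCard_gal {L : Type*} [Field L] [NumberField L] [IsGalois ℚ L]
    {f : ℤ[X]} (hf : f.Monic) (hs : (f.map (algebraMap ℤ L)).Splits) (p : ℕ) [Fact p.Prime]
    {q : (ZMod p)[X]} (hq : Irreducible q) (hqf : q ∣ f.map (Int.castRingHom (ZMod p))) :
    q.natDegree ∣ Nat.card (L ≃ₐ[ℚ] L) := by
  have hp : p.Prime := Fact.out
  have hpI : Prime (p : ℤ) := Nat.prime_iff_prime_int.mp hp
  have hmax : (Ideal.span {(p : ℤ)}).IsMaximal :=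
    ((Ideal.span_singleton_prime hpI.ne_zero).mpr hpI).isMaximal (by simpa using hp.ne_zero)
  obtain ⟨P, hPmax, hP⟩ := Ideal.exists_maximal_ideal_liesOver_of_isIntegral (S := 𝓞 L)
    (Ideal.span {(p : ℤ)})
  have hcard : P.inertiaDeg ℤ ∣ Nat.card (L ≃ₐ[ℚ] L) := by
    rw [← Ideal.ncard_primesOver_mul_ramificationIdxIn_mul_inertiaDegIn (Ideal.span {(p : ℤ)}) (𝓞 L)
      (L ≃ₐ[ℚ] L), Ideal.inertiaDegIn_eq_inertiaDeg (Ideal.span {(p : ℤ)}) P (L ≃ₐ[ℚ] L)]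
    exact (dvd_mul_left _ _).mul_left _
  refine dvd_trans ?_ hcard
  let := Ideal.Quotient.field P
  have hN := Ideal.absNorm_eq_pow_inertiaDeg' P hp
  have hpP : (p : 𝓞 L ⧸ P) = 0 := by
    have : (p : ℤ) ∈ P.under ℤ := by
      rw [← hP.over]; exact Ideal.mem_span_singleton_self _
    rw [Ideal.under_def, Ideal.mem_comap] at this
    simpa using Ideal.Quotient.eq_zero_iff_mem.mpr this
  have : CharP (𝓞 L ⧸ P) p := (CharP.charP_iff_prime_eq_zero hp).2 hpP
  let := ZMod.algebra (𝓞 L ⧸ P) p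
  rw [← Ideal.inertiaDeg'_eq_inertiaDeg (Ideal.span {(p : ℤ)}) P]
  have hPbot : P ≠ ⊥ := by
    exact Ideal.ne_bot_of_liesOver_of_ne_bot (p := Ideal.span {(p : ℤ)})
      (by simpa using hp.ne_zero) P
  have : Finite (𝓞 L ⧸ P) := P.finiteQuotientOfFreeOfNeBot hPbot
  have h2 : Nat.card (𝓞 L ⧸ P) = p ^ Module.finrank (ZMod p) (𝓞 L ⧸ P) := by
    simpa using Module.natCard_eq_pow_finrank (K := ZMod p) (V := 𝓞 L ⧸ P)
  rw [Ideal.absNorm_apply, Submodule.cardQuot_apply, h2] at hN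
  rw [← Nat.pow_right_injective hp.two_le hN]
  refine Polynomial.Irreducible.natDegree_dvd_finrank hq ?_
  obtain ⟨s, hs'⟩ : ∃ s : Multiset (𝓞 L), s.map (algebraMap (𝓞 L) L) =
      (f.map (algebraMap ℤ L)).roots := by
    have : ∀ x ∈ (f.map (algebraMap ℤ L)).roots, ∃ y, algebraMap (𝓞 L) L y = x := by
      intro x hx
      have : IsIntegral ℤ x := ⟨f, hf, by simpa [eval₂_eq_eval_map] using (mem_roots'.1 hx).2⟩
      exact ⟨⟨x, this⟩, rfl⟩
    choose! g hg using this
    exact ⟨(f.map (algebraMap ℤ L)).roots.map g, by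
      rw [Multiset.map_map]
      exact (Multiset.map_congr rfl hg).trans (Multiset.map_id' _)⟩
  have h3 : f.map (algebraMap ℤ (𝓞 L)) = (s.map (X - C ·)).prod := by
    apply Polynomial.map_injective (algebraMap (𝓞 L) L) (FaithfulSMul.algebraMap_injective (𝓞 L) L)
    rw [Polynomial.map_map, ← IsScalarTower.algebraMap_eq]
    rw [hs.eq_prod_roots_of_monic (hf.map _), ← hs', Polynomial.map_multiset_prod]
    simp
  have h4 : (f.map (Int.castRingHom (ZMod p))).map (algebraMap (ZMod p) (𝓞 L ⧸ P)) =
    (f.map (algebraMap ℤ (𝓞 L))).map (Ideal.Quotient.mk P) := by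
    rw [Polynomial.map_map, Polynomial.map_map]
    congr 1
    exact RingHom.ext_int _ _
  refine Splits.of_dvd ?_ ?_ (map_dvd (Polynomial.mapRingHom (algebraMap (ZMod p) (𝓞 L ⧸ P))) hqf)
  · simp only [coe_mapRingHom]
    rw [h4, h3, Polynomial.map_multiset_prod]
    refine .multisetProd ?_
    simp +contextual [Splits.X_sub_C]
  · simp only [coe_mapRingHom]
    exact (((hf.map _).map _)).ne_zero

theorem splits_of_forall_isRoot {K ι : Type*} [Field K] [Fintype ι] {P : K[X]} {a : ι → K}
    (ha : a.Injective) (h : ∀ i, P.IsRoot (a i)) (hP : P ≠ 0)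
    (hdeg : P.natDegree = Fintype.card ι) :
    P.Splits ∧ ∀ x, P.IsRoot x → ∃ i, a i = x := by
  have hle : Finset.univ.val.map a ≤ P.roots := by
    rw [Multiset.le_iff_subset ((Multiset.nodup_map_iff_of_injective ha).2 Finset.univ.nodup)]
    intro x hx
    obtain ⟨i, -, rfl⟩ := Multiset.mem_map.1 hx
    exact (mem_roots hP).2 (h i)
  have heq : Finset.univ.val.map a = P.roots := by
    refine Multiset.eq_of_le_of_card_le hle ?_
    simpa [hdeg] using P.card_roots'
  refine ⟨splits_iff_card_roots.2 ?_, fun x hx => ?_⟩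
  · simp [← heq, hdeg]
  · rw [← mem_roots hP, ← heq, Multiset.mem_map] at hx
    exact hx.imp fun _ h => h.2

theorem eq_zero_of_forall_norm_le {L : Type*} [Field L] [NumberField L] [IsGalois ℚ L] {p : ℕ}
    [Fact p.Prime] {k : ℕ} {C : ℝ} (hC : C < p ^ k) (φ : L →+* ℚ_[p]) (ψ : L →+* ℂ) {u : L}
    (hu : IsIntegral ℤ u)
    (hφ : ∀ σ : L ≃ₐ[ℚ] L, ‖φ (σ u)‖ ≤ (p : ℝ) ^ (-k : ℤ))
    (hψ : ∀ σ : L ≃ₐ[ℚ] L, ‖ψ (σ u)‖ ≤ C) : u = 0 := by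
  obtain ⟨n, hn⟩ := IsIntegrallyClosed.isIntegral_iff.1 (Algebra.isIntegral_norm ℚ hu)
  have hprod := Algebra.norm_eq_prod_automorphisms ℚ u
  rw [← hn] at hprod
  have h1 := congrArg φ hprod
  have h2 := congrArg ψ hprod
  simp only [map_prod, eq_intCast, map_intCast] at h1 h2
  set d := Fintype.card (L ≃ₐ[ℚ] L) with hd
  have hd0 : d ≠ 0 := Fintype.card_ne_zero
  have h3 : ‖(n : ℚ_[p])‖ ≤ (p : ℝ) ^ (-((k * d : ℕ) : ℤ)) := by
    rw [h1, norm_prod]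
    refine (Finset.prod_le_prod (fun _ _ => norm_nonneg _) fun σ _ => hφ σ).trans ?_
    rw [Finset.prod_const, Finset.card_univ, ← hd, ← zpow_natCast, ← zpow_mul]
    push_cast
    rw [neg_mul]
  have hC0 : 0 ≤ C := (norm_nonneg _).trans (hψ 1)
  have h4 : |(n : ℝ)| < (p : ℝ) ^ (k * d) := by
    have : |(n : ℝ)| = ‖(n : ℂ)‖ := by simp
    rw [this, h2, norm_prod]
    refine (Finset.prod_le_prod (fun _ _ => norm_nonneg _) fun σ _ => hψ σ).trans_lt ?_
    rw [Finset.prod_const, Finset.card_univ, ← hd, pow_mul]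
    exact pow_lt_pow_left₀ hC hC0 hd0
  have h5 : n = 0 := by
    refine Int.eq_zero_of_abs_lt_dvd ((Padic.norm_int_le_pow_iff_dvd n _).1 h3) ?_
    exact_mod_cast h4
  rw [h5, map_zero, eq_comm, Algebra.norm_eq_zero_iff] at hn
  exact hn

namespace CoeffList

section Arithmetic

variable {R S : Type*} [CommRing R] [CommRing S] (a : R)

/-- The value at `a` of the polynomial with the given list of coefficients, constant term first. -/
def eval (a : R) : List ℤ → R
  | [] => 0
  | c :: l => c + a * eval a l

theorem map_eval (φ : R →+* S) (l : List ℤ) : φ (eval a l) = eval (φ a) l := by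
  induction l with
  | nil => simp [eval]
  | cons c l ih => simp [eval, ih]

/-- `u + c * v` modulo `p` -/
def axpy (p : ℤ) (c : ℤ) : List ℤ → List ℤ → List ℤ
  | u, [] => u
  | [], y :: v => (c * y) % p :: axpy p c [] v
  | x :: u, y :: v => (x + c * y) % p :: axpy p c u v

/-- Remove the entries beyond position `n` if they all vanish. -/
def trim (n : ℕ) (u : List ℤ) : List ℤ :=
  if (u.drop n).all (· == 0) then u.take n else u

/-- Multiplication by the variable modulo `p` and the monic polynomial `q` of degree `n`. -/
def shift (p : ℤ) (n : ℕ) (q u : List ℤ) : List ℤ :=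
  trim n (axpy p (-((0 :: u).getD n 0)) (0 :: u) q)

/-- Multiplication modulo `p` and the monic polynomial `q` of degree `n`. -/
def mul (p : ℤ) (n : ℕ) (q u : List ℤ) : List ℤ → List ℤ
  | [] => []
  | y :: v => axpy p y (shift p n q (mul p n q u v)) u

/-- The `k`-th power modulo `p` and the monic polynomial `q` of degree `n`. -/
def pow (p : ℤ) (n : ℕ) (q u : List ℤ) : ℕ → List ℤ
  | 0 => [1]
  | k + 1 => mul p n q u (pow p n q u k)

/-- The power with exponent `k ^ m` modulo `p` and the monic polynomial `q` of degree `n`. -/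
def iteratePow (p : ℤ) (n : ℕ) (q u : List ℤ) (k : ℕ) : ℕ → List ℤ
  | 0 => u
  | m + 1 => pow p n q (iteratePow p n q u k m) k

theorem eval_eq_zero_of_all {u : List ℤ} (h : u.all (· == 0) = true) : eval a u = 0 := by
  induction u with
  | nil => rfl
  | cons x u ih =>
    simp only [List.all_cons, Bool.and_eq_true, beq_iff_eq] at h
    simp [eval, h.1, ih h.2]

theorem eval_take_add_drop (n : ℕ) (u : List ℤ) :
    eval a (u.take n) + a ^ n * eval a (u.drop n) = eval a u := by
  induction n generalizing u with
  | zero => simp [eval]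
  | succ n ih =>
    cases u with
    | nil => simp [eval]
    | cons x u => simp only [List.take_succ_cons, List.drop_succ_cons, eval, ← ih u]; ring

theorem eval_trim (n : ℕ) (u : List ℤ) : eval a (trim n u) = eval a u := by
  unfold trim
  split_ifs with h
  · rw [← eval_take_add_drop a n u, eval_eq_zero_of_all a h, mul_zero, add_zero]
  · rfl

variable {a}

theorem cast_emod {p : ℤ} (hp : (p : R) = 0) (x : ℤ) : ((x % p : ℤ) : R) = x := by
  rw [Int.emod_def]; simp [hp]

variable {p : ℤ} {n : ℕ} {q : List ℤ}

theorem eval_axpy (hp : (p : R) = 0) (c : ℤ) (u v : List ℤ) :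
    eval a (axpy p c u v) = eval a u + c * eval a v := by
  induction v generalizing u with
  | nil => simp [axpy, eval]
  | cons y v ih =>
    cases u with
    | nil => simp [axpy, eval, ih, cast_emod hp]; ring
    | cons x u => simp [axpy, eval, ih, cast_emod hp]; ring

theorem eval_shift (hp : (p : R) = 0) (hq : eval a q = 0) (u : List ℤ) :
    eval a (shift p n q u) = a * eval a u := by
  simp [shift, eval_trim, eval_axpy hp, hq, eval]

theorem eval_mul (hp : (p : R) = 0) (hq : eval a q = 0) (u v : List ℤ) :
    eval a (mul p n q u v) = eval a u * eval a v := by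
  induction v with
  | nil => simp [mul, eval]
  | cons y v ih => simp only [mul, eval_axpy hp, eval_shift hp hq, ih, eval]; ring

theorem eval_pow (hp : (p : R) = 0) (hq : eval a q = 0) (u : List ℤ) (k : ℕ) :
    eval a (pow p n q u k) = eval a u ^ k := by
  induction k with
  | zero => simp [pow, eval]
  | succ k ih => rw [pow, eval_mul hp hq, ih, pow_succ']

theorem eval_iteratePow (hp : (p : R) = 0) (hq : eval a q = 0) (u : List ℤ) (k m : ℕ) :
    eval a (iteratePow p n q u k m) = eval a u ^ k ^ m := by
  induction m with
  | zero => simp [iteratePow]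
  | succ m ih => rw [iteratePow, eval_pow hp hq, ih, ← pow_mul, ← pow_succ]

end Arithmetic

/-- A certificate that the monic polynomial `q` of prime degree `n` is irreducible modulo `p`:
modulo `q`, one has `x ^ p ^ n = x`, and `x ^ p - x` has inverse `w`. -/
def irreducibleCert (p n : ℕ) (q w : List ℤ) : Bool :=
  (axpy p (-1) (iteratePow p n q [0, 1] p n) [0, 1]).all (· == 0) &&
    (axpy p (-1) (mul p n q w (axpy p (-1) (pow p n q [0, 1] p) [0, 1])) [1]).all (· == 0)

theorem irreducible_of_irreducibleCert {p n : ℕ} [Fact p.Prime] (hn : n.Prime) {q w : List ℤ}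
    (hdeg : (eval X q : (ZMod p)[X]).natDegree = n) (h : irreducibleCert p n q w = true) :
    Irreducible (eval X q : (ZMod p)[X]) := by
  rw [irreducibleCert, Bool.and_eq_true] at h
  have hunit : ¬ IsUnit (eval X q : (ZMod p)[X]) := fun hu => by
    rw [natDegree_eq_zero_of_isUnit hu] at hdeg; exact hn.ne_zero hdeg.symm
  have h0 : (eval X q : (ZMod p)[X]) ≠ 0 := fun h0 => by
    rw [h0, natDegree_zero] at hdeg; exact hn.ne_zero hdeg.symm
  obtain ⟨m, hm, hmq⟩ := WfDvdMonoid.exists_irreducible_factor hunit h0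
  have : Fact (Irreducible m) := ⟨hm⟩
  have hp : (((p : ℕ) : ℤ) : AdjoinRoot m) = 0 := by
    have := map_natCast (algebraMap (ZMod p) (AdjoinRoot m)) p
    rw [CharP.cast_eq_zero, map_zero] at this
    exact_mod_cast this.symm
  have hroot : eval (AdjoinRoot.root m) q = 0 := by
    rw [← AdjoinRoot.mk_X, ← map_eval, AdjoinRoot.mk_eq_zero]
    exact hmq
  have h1 := eval_eq_zero_of_all (AdjoinRoot.root m) h.1
  have h2 := eval_eq_zero_of_all (AdjoinRoot.root m) h.2
  simp only [eval_axpy hp, eval_iteratePow hp hroot, eval_pow hp hroot,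
    eval_mul hp hroot, eval] at h1 h2
  simp only [Int.cast_zero, Int.cast_one, mul_zero, add_zero, zero_add, mul_one, Int.cast_neg,
    neg_mul, one_mul, ← sub_eq_add_neg] at h1 h2
  have hd : m.natDegree ∣ n := by
    apply hm.natDegree_dvd_of_dvd_X_pow_card_pow_sub_X
    rw [← AdjoinRoot.mk_eq_zero]
    simpa using h1
  rcases (Nat.dvd_prime hn).1 hd with hd | hd
  · have := (hm.natDegree_dvd_iff_dvd_X_pow_card_pow_sub_X (n := 1)).1 (by rw [hd])
    rw [← AdjoinRoot.mk_eq_zero] at this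
    simp only [Nat.card_zmod, pow_one, map_sub, map_pow, AdjoinRoot.mk_X] at this
    simp [this] at h2
  · exact (associated_of_dvd_of_natDegree_le hmq h0 (by rw [hd, hdeg])).irreducible hm

/-- The coefficients of the polynomial under study. -/
def F : List ℤ := [21, 18, 141, 60, 150, 162, 141, 42, 60, 0, -9, -2, 1]

theorem irreducible_seven :
    Irreducible (eval X [4, 1, 4, 3, 1, 1, 0, 4, 0, 5, 5, 1] : (ZMod 7)[X]) := by
  have : Fact (Nat.Prime 7) := ⟨by norm_num⟩
  refine irreducible_of_irreducibleCert (n := 11) (w := [4, 6, 6, 3, 6, 6, 6, 2, 5, 3, 3])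
    (by norm_num) ?_ (by decide +kernel)
  simp only [eval, mul_zero, add_zero, Int.cast_one, Int.cast_zero, zero_add, mul_one]
  compute_degree!

theorem irreducible_nineteen : Irreducible (eval X [14, 0, 14, 4, 3, 1] : (ZMod 19)[X]) := by
  have : Fact (Nat.Prime 19) := ⟨by norm_num⟩
  refine irreducible_of_irreducibleCert (n := 5) (w := [9, 14, 17, 12, 17])
    (by norm_num) ?_ (by decide +kernel)
  simp only [eval, mul_zero, add_zero, Int.cast_one, Int.cast_zero, zero_add, mul_one]
  compute_degree!

theorem eval_X_dvd {p : ℕ} {l u v : List ℤ}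
    (h : (axpy p (-1) l (mul p l.length [] u v)).all (· == 0) = true) :
    (eval X u : (ZMod p)[X]) ∣ eval X l := by
  have hp : ((p : ℤ) : (ZMod p)[X]) = 0 := by
    have := map_natCast (algebraMap (ZMod p) (ZMod p)[X]) p
    rw [CharP.cast_eq_zero, map_zero] at this
    exact_mod_cast this.symm
  have := eval_eq_zero_of_all (X : (ZMod p)[X]) h
  rw [eval_axpy hp, eval_mul hp (by simp [eval])] at this
  exact ⟨eval X v, by linear_combination this⟩

theorem map_eval_X {R S : Type*} [CommRing R] [CommRing S] (φ : R →+* S) (l : List ℤ) :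
    (eval X l : R[X]).map φ = eval X l := by
  rw [← coe_mapRingHom, map_eval, coe_mapRingHom, map_X]

theorem eval_eval_X {R : Type*} [CommRing R] (a : R) (l : List ℤ) :
    (eval X l : R[X]).eval a = eval a l := by
  rw [← coe_evalRingHom, map_eval, coe_evalRingHom, eval_X]

theorem aeval_eval_X {R S : Type*} [CommRing R] [CommRing S] [Algebra R S] (a : S) (l : List ℤ) :
    aeval a (eval X l : R[X]) = eval a l := by
  have := map_eval (X : R[X]) (aeval (R := R) a).toRingHom l
  simpa using this

theorem natDegree_eval_F (R : Type*) [CommRing R] [Nontrivial R] :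
    (eval X F : R[X]).natDegree = 12 := by
  simp only [eval, F, mul_zero, add_zero, Int.cast_one, Int.cast_zero, zero_add, mul_one]
  compute_degree!

theorem monic_eval_F (R : Type*) [CommRing R] : (eval X F : R[X]).Monic := by
  have : (eval X F : ℤ[X]).Monic := by
    simp only [eval, F, mul_zero, add_zero, Int.cast_one, Int.cast_zero, zero_add, mul_one]
    monicity!
  rw [← map_eval_X (Int.castRingHom R)]
  exact this.map _

theorem seven_dvd :
    (eval X [4, 1, 4, 3, 1, 1, 0, 4, 0, 5, 5, 1] : (ZMod 7)[X]) ∣ eval X F :=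
  eval_X_dvd (v := [0, 1]) (by decide +kernel)

theorem nineteen_dvd :
    (eval X [14, 0, 14, 4, 3, 1] : (ZMod 19)[X]) ∣ eval X F :=
  eval_X_dvd (v := [11, 4, 14, 8, 0, 2, 14, 1]) (by decide +kernel)

theorem natDegree_seven :
    (eval X [4, 1, 4, 3, 1, 1, 0, 4, 0, 5, 5, 1] : (ZMod 7)[X]).natDegree = 11 := by
  have : Fact (Nat.Prime 7) := ⟨by norm_num⟩
  simp only [eval, mul_zero, add_zero, Int.cast_one, Int.cast_zero, zero_add, mul_one]
  compute_degree!

theorem natDegree_nineteen :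
    (eval X [14, 0, 14, 4, 3, 1] : (ZMod 19)[X]).natDegree = 5 := by
  have : Fact (Nat.Prime 19) := ⟨by norm_num⟩
  simp only [eval, mul_zero, add_zero, Int.cast_one, Int.cast_zero, zero_add, mul_one]
  compute_degree!

theorem eval_F_zmod_eleven_ne_zero (a : ZMod 11) : eval a F ≠ 0 := by
  revert a
  decide

theorem irreducible_eval_F_int : Irreducible (eval X F : ℤ[X]) := by
  have : Fact (Nat.Prime 7) := ⟨by norm_num⟩
  have key (f g : ℤ[X]) (hg : g.Monic) (hfg : f * g = eval X F)
      (hf : eval X [4, 1, 4, 3, 1, 1, 0, 4, 0, 5, 5, 1] ∣ f.map (Int.castRingHom (ZMod 7)))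
      (hfm : f.Monic) : g.natDegree = 0 := by
    have h1 := natDegree_le_of_dvd hf (hfm.map _).ne_zero
    rw [natDegree_seven, hfm.natDegree_map] at h1
    have h2 := congrArg natDegree hfg
    rw [hfm.natDegree_mul hg, natDegree_eval_F] at h2
    by_contra h3
    have h4 : g.natDegree = 1 := by omega
    have h5 := congrArg (fun t => (t.map (Int.castRingHom (ZMod 11))).eval
      (-(g.coeff 0 : ZMod 11))) hfg
    simp only [map_eval_X, eval_eval_X, Polynomial.map_mul, Polynomial.eval_mul] at h5
    refine eval_F_zmod_eleven_ne_zero _ (h5.symm.trans ?_)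
    rw [hg.eq_X_add_C h4]
    simp
  refine ((monic_eval_F ℤ).irreducible_iff_natDegree).2 ⟨fun h => ?_, fun f g hf hg hfg => ?_⟩
  · simpa [h] using natDegree_eval_F ℤ
  · have h1 := seven_dvd
    rw [← map_eval_X (Int.castRingHom (ZMod 7)) F, ← hfg, Polynomial.map_mul] at h1
    rcases (irreducible_seven.prime).dvd_or_dvd h1 with h1 | h1
    · exact .inr (key f g hg hfg h1 hf)
    · exact .inl (key g f hf (by rw [mul_comm, hfg]) h1 hg)

theorem irreducible_eval_F : Irreducible (eval X F : ℚ[X]) := by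
  rw [← map_eval_X (algebraMap ℤ ℚ)]
  exact ((monic_eval_F ℤ).irreducible_iff_irreducible_map_fraction_map).1 irreducible_eval_F_int

theorem twelve_dvd {L : Type*} [Field L] [NumberField L] [IsGalois ℚ L] {b : L}
    (hb : eval b F = 0) : 12 ∣ Nat.card (L ≃ₐ[ℚ] L) := by
  have h : aeval b (eval X F : ℚ[X]) = 0 := by rw [aeval_eval_X, hb]
  rw [IsGalois.card_aut_eq_finrank, ← natDegree_eval_F ℚ,
    minpoly.eq_of_irreducible_of_monic irreducible_eval_F h (monic_eval_F ℚ)]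
  exact minpoly.degree_dvd (Algebra.IsIntegral.isIntegral b)

theorem dvd_natCard_gal {L : Type*} [Field L] [NumberField L] [IsGalois ℚ L]
    (hL : (eval X F : L[X]).Splits) : 660 ∣ Nat.card (L ≃ₐ[ℚ] L) := by
  have : Fact (Nat.Prime 7) := ⟨by norm_num⟩
  have : Fact (Nat.Prime 19) := ⟨by norm_num⟩
  have hs : ((eval X F : ℤ[X]).map (algebraMap ℤ L)).Splits := by rwa [map_eval_X]
  obtain ⟨b, hb⟩ := hL.exists_eval_eq_zero (by
    rw [degree_eq_natDegree (monic_eval_F L).ne_zero, natDegree_eval_F]; norm_num)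
  have h12 := twelve_dvd (L := L) (b := b) (by rwa [eval_eval_X] at hb)
  have h11 := natDegree_dvd_natCard_gal (monic_eval_F ℤ) hs 7 irreducible_seven
    (by rw [map_eval_X]; exact seven_dvd)
  have h5 := natDegree_dvd_natCard_gal (monic_eval_F ℤ) hs 19 irreducible_nineteen
    (by rw [map_eval_X]; exact nineteen_dvd)
  rw [natDegree_seven] at h11
  rw [natDegree_nineteen] at h5
  omega

section Derivative

variable {R S : Type*} [CommRing R] [CommRing S]

/-- The value at `a` of the derivative of the polynomial with the given list of coefficients. -/
def evalDeriv (a : R) : List ℤ → R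
  | [] => 0
  | _ :: l => eval a l + a * evalDeriv a l

theorem map_evalDeriv (φ : R →+* S) (a : R) (l : List ℤ) :
    φ (evalDeriv a l) = evalDeriv (φ a) l := by
  induction l with
  | nil => simp [evalDeriv]
  | cons c l ih => simp [evalDeriv, map_eval, ih]

theorem derivative_eval_X (l : List ℤ) :
    derivative (eval X l : R[X]) = evalDeriv X l := by
  induction l with
  | nil => simp [eval, evalDeriv]
  | cons c l ih => simp [eval, evalDeriv, ih]

theorem exists_eval_sub_eval (x y : R) (l : List ℤ) :
    ∃ k, eval x l - eval y l = (x - y) * (evalDeriv y l + (x - y) * k) := by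
  induction l with
  | nil => exact ⟨0, by simp [eval, evalDeriv]⟩
  | cons c l ih =>
    obtain ⟨k, hk⟩ := ih
    refine ⟨evalDeriv y l + x * k, ?_⟩
    simp only [eval, evalDeriv]
    linear_combination x * hk

end Derivative

section Padic

variable {p : ℕ} [Fact p.Prime]

theorem isUnit_of_toZMod_ne_zero {x : ℤ_[p]} (h : PadicInt.toZMod x ≠ 0) : IsUnit x := by
  by_contra hx
  refine h ?_
  rw [← RingHom.mem_ker, PadicInt.ker_toZMod]
  exact hx

theorem eq_of_toZMod_eq {l : List ℤ} {x y : ℤ_[p]} (hx : eval x l = 0) (hy : eval y l = 0)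
    (hxy : PadicInt.toZMod x = PadicInt.toZMod y)
    (hd : evalDeriv (PadicInt.toZMod y) l ≠ 0) : x = y := by
  obtain ⟨k, hk⟩ := exists_eval_sub_eval x y l
  rw [hx, hy, sub_self, eq_comm, mul_eq_zero] at hk
  refine hk.elim sub_eq_zero.1 fun h => (hd ?_).elim
  have := congrArg PadicInt.toZMod h
  simpa [map_evalDeriv, hxy] using this

theorem exists_padicInt_root {l : List ℤ} {k : ℕ} (hk : k ≠ 0) {a : ℤ}
    (h : eval (a : ZMod (p ^ k)) l = 0) (hd : evalDeriv (a : ZMod p) l ≠ 0) :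
    ∃ z : ℤ_[p], eval z l = 0 ∧ PadicInt.toZMod z = a ∧ PadicInt.toZModPow k z = a := by
  have h' : eval (a : ZMod p) l = 0 := by
    have := congrArg (ZMod.castHom (dvd_pow_self p hk) (ZMod p)) h
    rwa [map_eval, map_intCast, map_zero] at this
  have hu (x : ℤ_[p]) (hx : PadicInt.toZMod x ≠ 0) : ‖x‖ = 1 :=
    PadicInt.isUnit_iff.1 (isUnit_of_toZMod_ne_zero hx)
  have hz (x : ℤ_[p]) (hx : PadicInt.toZMod x = 0) : ‖x‖ < 1 := by
    rw [← PadicInt.mem_nonunits, ← IsLocalRing.mem_maximalIdeal, ← PadicInt.ker_toZMod]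
    exact hx
  have hd1 : ‖evalDeriv (a : ℤ_[p]) l‖ = 1 := hu _ (by rwa [map_evalDeriv, map_intCast])
  have hd2 : (eval X l : ℤ_[p][X]).derivative.aeval (a : ℤ_[p]) = evalDeriv (a : ℤ_[p]) l := by
    rw [derivative_eval_X, coe_aeval_eq_eval, ← coe_evalRingHom, map_evalDeriv]
    simp
  obtain ⟨z, hz0, hza, -⟩ := hensels_lemma (p := p) (F := (eval X l : ℤ_[p][X]))
    (a := (a : ℤ_[p])) (by
      rw [aeval_eval_X, hd2, hd1, one_pow]
      exact hz _ (by rwa [map_eval, map_intCast]))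
  rw [aeval_eval_X] at hz0
  rw [hd2, hd1] at hza
  have hza' : PadicInt.toZMod z = a := by
    rw [← sub_eq_zero, ← map_intCast PadicInt.toZMod, ← map_sub, ← RingHom.mem_ker,
      PadicInt.ker_toZMod, IsLocalRing.mem_maximalIdeal, PadicInt.mem_nonunits]
    exact hza
  refine ⟨z, hz0, hza', ?_⟩
  obtain ⟨c, hc⟩ := exists_eval_sub_eval z (a : ℤ_[p]) l
  have hunit : IsUnit (evalDeriv (a : ℤ_[p]) l + (z - a) * c) :=
    isUnit_of_toZMod_ne_zero (by simpa [map_evalDeriv, hza'] using hd)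
  have hc' := congrArg (PadicInt.toZModPow k) hc
  rw [hz0, zero_sub, map_neg, map_eval, map_intCast, h, neg_zero, map_mul, eq_comm,
    (hunit.map _).mul_left_eq_zero, map_sub, map_intCast, sub_eq_zero] at hc'
  exact hc'

end Padic

section Bivariate

variable {R S : Type*} [CommRing R] [CommRing S]

/-- The value at `(a, b)` of a polynomial in the second variable whose coefficients are
polynomials in the first one. -/
def eval₂ (a b : R) : List (List ℤ) → R
  | [] => 0
  | c :: l => eval a c + b * eval₂ a b l

theorem map_eval₂ (φ : R →+* S) (a b : R) (l : List (List ℤ)) :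
    φ (eval₂ a b l) = eval₂ (φ a) (φ b) l := by
  induction l with
  | nil => simp [eval₂]
  | cons c l ih => simp [eval₂, map_eval, ih]

/-- The remainder modulo `N` of the value at an integer. -/
def evalMod (N a : ℤ) : List ℤ → ℤ
  | [] => 0
  | c :: l => (c + a * evalMod N a l) % N

theorem cast_evalMod {N : ℤ} (hN : (N : R) = 0) (a : ℤ) (l : List ℤ) :
    (evalMod N a l : R) = eval (a : R) l := by
  induction l with
  | nil => simp [evalMod, eval]
  | cons c l ih => simp [evalMod, eval, cast_emod hN, ih]

theorem cast_evalMod_map {N : ℤ} (hN : (N : R) = 0) (a b : ℤ) (l : List (List ℤ)) :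
    (evalMod N b (l.map (evalMod N a)) : R) = eval₂ (a : R) (b : R) l := by
  induction l with
  | nil => simp [evalMod, eval₂]
  | cons c l ih =>
    rw [cast_evalMod hN] at ih
    simp [evalMod, eval₂, cast_emod hN, cast_evalMod hN, ih]

theorem norm_eval_le {z : ℂ} {r : ℝ} (hz : ‖z‖ ≤ r) (l : List ℤ) :
    ‖eval z l‖ ≤ eval r (l.map (|·|)) := by
  have hr : 0 ≤ r := (norm_nonneg z).trans hz
  induction l with
  | nil => simp [eval]
  | cons c l ih =>
    simp only [eval, List.map_cons]
    refine (norm_add_le _ _).trans ?_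
    rw [norm_mul]
    gcongr
    simp

theorem norm_eval₂_le {z w : ℂ} {r : ℤ} (hz : ‖z‖ ≤ r) (hw : ‖w‖ ≤ r) (l : List (List ℤ)) :
    ‖eval₂ z w l‖ ≤ (eval r (l.map fun c => eval r (c.map (|·|))) : ℤ) := by
  have hr : (0 : ℝ) ≤ r := (norm_nonneg z).trans hz
  induction l with
  | nil => simp [eval₂, eval]
  | cons c l ih =>
    simp only [eval₂, eval, List.map_cons]
    refine (norm_add_le _ _).trans ?_
    rw [norm_mul]
    push_cast at ih ⊢
    gcongr
    refine (norm_eval_le hz c).trans_eq ?_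
    simpa using (map_eval r (Int.castRingHom ℝ) (c.map (|·|))).symm

end Bivariate

theorem norm_le_of_eval_F {z : ℂ} (hz : eval z F = 0) : ‖z‖ ≤ 5 := by
  by_contra! h
  obtain ⟨t, ht⟩ : ∃ t, t = ‖z‖ - 5 := ⟨_, rfl⟩
  have ht0 : 0 < t := by linarith
  have h1 : z ^ 12 = - eval z [21, 18, 141, 60, 150, 162, 141, 42, 60, 0, -9, -2] := by
    simp only [eval, F] at hz ⊢
    linear_combination hz
  have h2 := congrArg norm h1
  rw [norm_pow, norm_neg] at h2
  have h3 := norm_eval_le le_rfl (z := z) [21, 18, 141, 60, 150, 162, 141, 42, 60, 0, -9, -2]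
  rw [← h2, ← sub_nonneg, show ‖z‖ = 5 + t by linarith] at h3
  refine h3.not_gt ?_
  rw [← neg_pos]
  simp only [List.map_cons, List.map_nil, eval]
  simp only [abs_neg, Nat.abs_ofNat, Int.cast_ofNat, abs_zero, Int.cast_zero]
  ring_nf
  positivity

/-- The coefficients of a symmetric polynomial `H(x, y)` which takes only `11` values on the pairs
of distinct roots of `F`. -/
def H : List (List ℤ) :=
  [[0, 1008042780, 675464139, 588750012, 300387108, -4930212, -298513248, -37620345, 32973956,
     9467440, -3322003],
   [1008042780, 803594253, -412920867, 379741899, 1137936984, -900311262, 393454341, 171478204,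
     -33124669, -36826889, 8924166],
   [675464139, -412920867, -1013759790, 215416794, -990911484, -307721919, -328936417, 13091194,
     42031100, 13378868, -5763283],
   [588750012, 379741899, 215416794, 552608664, 2124408783, -421960308, 389976711, 96110874,
     -41847047, -34003314, 9854717],
   [300387108, 1137936984, -990911484, 2124408783, 270605959, -139592351, -361432632, -12505275,
     28947104, 11952994, -3860470],
   [-4930212, -900311262, -307721919, -421960308, -139592351, -746439169, -261359661, 70789732,
     49852359, -3520693, -2619101],
   [-298513248, 393454341, -328936417, 389976711, -361432632, -261359661, -66815506, 33368769,
     9286573, 636365, -1054530],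
   [-37620345, 171478204, 13091194, 96110874, -12505275, 70789732, 33368769, -5137482, -6538120,
     185742, 356207],
   [32973956, -33124669, 42031100, -41847047, 28947104, 49852359, 9286573, -6538120, -1797213,
     321522, 91340],
   [9467440, -36826889, 13378868, -34003314, 11952994, -3520693, 636365, 185742, 321522, -205291,
     30181],
   [-3322003, 8924166, -5763283, 9854717, -3860470, -2619101, -1054530, 356207, 91340, 30181,
     -15204]]

/-- The coefficients of the monic polynomial whose roots are the values of `H` at the pairs of
distinct roots of `F`. -/
def G : List ℤ :=
  [
   1373538841529432709232194902584024179249810750048236650130875103343492485802501892475221437120884457,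
   16152297710389726165901926565137623157557318851556500919869446103713008789121784922220886739,
   65376146825582858661033435883224500889969025448626863433912791246457833653096622615,
   124850489666605442378438075469341676481142086552710596973075317707029684165,
   167244211795322026993059277791521334146835884400770708162598882810,
   151017103871202295443929166311678138594753025355573480638,
   116796439292187854961847365677425071253205933166, 66708120937335823294675151152374084330,
   39440083636674211338942147405, 16696063082647861695, 6507963723, 1]

/-- Approximations modulo `38321 ^ 46` to the roots of `F` in `ℤ_[38321]`, labelled by the
projective line over `ZMod 11`, with the point at infinity last. -/
def approxRoot : List ℤ :=
  [
   1738342053933610527827934466869017194592567573128306485634643020022772660437220484538913909302083785118410723479695221084743123497541951076152562031407682993712175697536776741567303262586447435485220240972806525,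
   4407366144714117067895732005656747865312394521186970767289289259197477305432752084535394728014685564157072776517107567188571638790855701781809906465471287088328341387793675790492549153566273067926139284074693736,
   1023272260916262836774839186448520185377778332560307322176456835183896010667385139555702819858470975197411322628463510180811753676213446069696685677995999797330367618845361527555435179145363420532358325662294610,
   583459987310247004289326625034035492773792880693332734135149653391651036596869456281979129418508433606800918236861694480954171496563793387914363611285834130808397236753939443376686188974382177859342713844186218,
   5949349578588679881087366926431613690761754078921416585893086832114190529628223802763362230306567857836641556139934932244423368326933795699259133682885520589458540152298319955744727698016725852196666278709050778,
   3387853543327530979995879875821518898165028282831755676629377864773456537388343074438953035794846615041066148339318228450508346388177678254970665705363870396916335621624362433117844111463938201295583807372234479,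
   6396747521379469384901188317957357125864292075073198926448025533680089966449755022158207995250129253985645297065344031809770292857983686744771809310672752843645841652002127269827238979432784985788440568785117128,
   4159520314395072712734766572936746300196984197606876671643380906768588225544904062454353255811161026080961568559632184818337596928193134037865199749170410371863100809239031119551086933463526713895768012380659908,
   4703611998523646086378701207329862625057290689409810272122173535996237806023855607163744069798884697099578713013234816515010778455818377845280190579454818128936780753093753701829965362185336384529410028775902917,
   1910958430993208715276330221938342072087894048746613755133880101729106589170377134575983712364146293280514555881648423924102992060757134312608265678704107517637145072820026264727926739758486927871631149980468126,
   1462751243393356307093680092790149238221403088939861700182910779506903997600099555784402815724300262592896877857609264582087795847744675224614351676964148740079460517835763058648344347428845008821963270524655969,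
   5604881893021901919926135365969577533988549334624016800988752075574756120637990976720442575570254099664261315586551108172086560401205622284120313502205262498755100276910760753766981120907340834382085141035449934]

/-- The roots of `G` modulo `38321`. -/
def rootMod : List ℤ := [25608, 30894, 10759, 22137, 12055, 30921, 334, 36129, 701, 28414, 8718]

/-- The approximation to the root of `F` with the given label. -/
def approx (i : Fin 12) : ℤ := approxRoot.getD i 0

instance fact_prime : Fact (Nat.Prime 38321) := ⟨by norm_num⟩

theorem evalMod_approx : ∀ i, evalMod (38321 ^ 46 : ℕ) (approx i) F = 0 := by decide +kernel

theorem approx_emod_injective : ∀ i j, approx i % 38321 = approx j % 38321 → i = j := by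
  decide +kernel

theorem evalMod_approx_pair : ∀ i j, i ≠ j →
    evalMod (38321 ^ 46 : ℕ)
      (evalMod (38321 ^ 46 : ℕ) (approx j)
        (H.map (evalMod (38321 ^ 46 : ℕ) (approx i)))) G = 0 := by
  decide +kernel

theorem evalMod_H_approx : ∀ i j : Fin 12, i ≠ j →
    evalMod 38321 (approx j % 38321) (H.map (evalMod 38321 (approx i % 38321))) =
      rootMod.getD (ProjLine.color i j) 0 := by
  decide +kernel

theorem evalDeriv_F_ne : ∀ i, evalDeriv (approx i % 38321) F % 38321 ≠ 0 := by decide +kernel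

theorem evalDeriv_G_ne : ∀ i < 11, evalDeriv (rootMod.getD i 0) G % 38321 ≠ 0 := by decide +kernel

theorem rootMod_injective : ∀ i < 11, ∀ j < 11,
    (rootMod.getD i 0) % 38321 = (rootMod.getD j 0) % 38321 → i = j := by
  decide +kernel

theorem bound_lt : eval (eval (5 : ℤ) (H.map fun c => eval 5 (c.map (|·|)))) (G.map (|·|)) <
    (38321 ^ 46 : ℕ) := by decide +kernel

theorem exists_root (i : Fin 12) : ∃ z : ℤ_[38321], eval z F = 0 ∧ PadicInt.toZMod z = approx i ∧
    PadicInt.toZModPow 46 z = approx i := by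
  refine exists_padicInt_root (by norm_num) ?_ fun h => evalDeriv_F_ne i ?_
  · rw [← cast_evalMod (N := (38321 ^ 46 : ℕ)) (by rw [Int.cast_natCast, ZMod.natCast_self]),
      evalMod_approx, Int.cast_zero]
  · have hN : ((38321 : ℤ) : ZMod 38321) = 0 := by exact_mod_cast ZMod.natCast_self 38321
    rw [← cast_emod hN, ← eq_intCast (Int.castRingHom (ZMod 38321)), ← map_evalDeriv, eq_intCast,
      ZMod.intCast_zmod_eq_zero_iff_dvd] at h
    exact Int.emod_eq_zero_of_dvd h

/-- The root of `F` in `ℤ_[38321]` with the given label. -/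
noncomputable def root (i : Fin 12) : ℤ_[38321] := (exists_root i).choose

theorem eval_root (i : Fin 12) : eval (root i) F = 0 := (exists_root i).choose_spec.1

theorem toZMod_root (i : Fin 12) : PadicInt.toZMod (root i) = approx i :=
  (exists_root i).choose_spec.2.1

theorem toZModPow_root (i : Fin 12) : PadicInt.toZModPow 46 (root i) = approx i :=
  (exists_root i).choose_spec.2.2

theorem root_injective : Function.Injective root := by
  intro i j h
  refine approx_emod_injective i j ?_
  have := congrArg PadicInt.toZMod h
  rwa [toZMod_root, toZMod_root, ZMod.intCast_eq_intCast_iff'] at this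

theorem norm_eval_G_root {i j : Fin 12} (hij : i ≠ j) :
    ‖eval (eval₂ (root i) (root j) H) G‖ ≤ (38321 : ℕ) ^ (-(46 : ℕ) : ℤ) := by
  rw [PadicInt.norm_le_pow_iff_mem_span_pow, ← PadicInt.ker_toZModPow, RingHom.mem_ker, map_eval,
    map_eval₂, toZModPow_root, toZModPow_root]
  have hN : (((38321 ^ 46 : ℕ) : ℤ) : ZMod (38321 ^ 46)) = 0 := by
    rw [Int.cast_natCast, ZMod.natCast_self]
  rw [← cast_evalMod_map hN, ← cast_evalMod hN, evalMod_approx_pair i j hij, Int.cast_zero]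

theorem toZMod_eval₂_root {i j : Fin 12} (hij : i ≠ j) :
    PadicInt.toZMod (eval₂ (root i) (root j) H) =
      ((rootMod.getD (ProjLine.color i j) 0 : ℤ) : ZMod 38321) := by
  have hN : ((38321 : ℤ) : ZMod 38321) = 0 := by
    exact_mod_cast ZMod.natCast_self 38321
  rw [map_eval₂, toZMod_root, toZMod_root, ← evalMod_H_approx i j hij, cast_evalMod_map hN,
    cast_emod hN, cast_emod hN]

theorem coe_eval {p : ℕ} [Fact p.Prime] (z : ℤ_[p]) (l : List ℤ) :
    ((eval z l : ℤ_[p]) : ℚ_[p]) = eval (z : ℚ_[p]) l :=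
  map_eval _ PadicInt.Coe.ringHom l

theorem coe_eval₂ {p : ℕ} [Fact p.Prime] (z w : ℤ_[p]) (l : List (List ℤ)) :
    ((eval₂ z w l : ℤ_[p]) : ℚ_[p]) = eval₂ (z : ℚ_[p]) (w : ℚ_[p]) l :=
  map_eval₂ PadicInt.Coe.ringHom z w l

theorem splits_padic : ((eval X F : ℚ[X]).map (algebraMap ℚ ℚ_[38321])).Splits ∧
    ∀ x : ℚ_[38321], eval x F = 0 → ∃ i, (root i : ℚ_[38321]) = x := by
  have h := splits_of_forall_isRoot (P := (eval X F : ℚ_[38321][X]))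
    (a := fun i => (root i : ℚ_[38321])) (fun i j hij => root_injective (PadicInt.ext hij))
    (fun i => ?_) (monic_eval_F _).ne_zero (by rw [natDegree_eval_F, Fintype.card_fin])
  · rw [map_eval_X]
    exact ⟨h.1, fun x hx => h.2 x (by rwa [IsRoot.def, eval_eval_X])⟩
  · rw [IsRoot.def, eval_eval_X]
    rw [← coe_eval, eval_root, PadicInt.coe_zero]

section NumberField

variable {L : Type*} [Field L] [NumberField L]

theorem exists_roots [hL : IsSplittingField ℚ L (eval X F)] :
    ∃ (φ : L →+* ℚ_[38321]) (β : Fin 12 → L), (∀ i, φ (β i) = root i) ∧ (∀ i, eval (β i) F = 0) ∧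
      ∀ x, eval x F = 0 → ∃ i, β i = x := by
  let φ : L →ₐ[ℚ] ℚ_[38321] := IsSplittingField.lift L (eval X F) splits_padic.1
  have hne : (eval X F : ℚ[X]) ≠ 0 := (monic_eval_F _).ne_zero
  have himage := (IsSplittingField.splits L (eval X F : ℚ[X])).image_rootSet φ
  have hmem (i : Fin 12) : ∃ x : L, eval x F = 0 ∧ φ x = root i := by
    have h : (root i : ℚ_[38321]) ∈ (eval X F : ℚ[X]).rootSet ℚ_[38321] := by
      rw [mem_rootSet_of_ne hne, aeval_eval_X]
      rw [← coe_eval, eval_root, PadicInt.coe_zero]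
    rw [← himage] at h
    obtain ⟨x, hx, hxi⟩ := h
    rw [mem_rootSet_of_ne hne, aeval_eval_X] at hx
    exact ⟨x, hx, hxi⟩
  choose β hβ hβi using hmem
  refine ⟨φ, β, hβi, hβ, fun x hx => ?_⟩
  obtain ⟨i, hi⟩ := splits_padic.2 (φ x) (by
    rw [← RingHom.coe_coe φ, ← map_eval, hx, map_zero])
  exact ⟨i, φ.injective ((hβi i).trans hi)⟩

theorem eval_G_eq_zero [IsGalois ℚ L] {φ : L →+* ℚ_[38321]} {β : Fin 12 → L}
    (hφ : ∀ i, φ (β i) = root i) (hβ : ∀ i, eval (β i) F = 0)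
    (hβ' : ∀ x, eval x F = 0 → ∃ i, β i = x) {i j : Fin 12} (hij : i ≠ j) :
    eval (eval₂ (β i) (β j) H) G = 0 := by
  have hinj : β.Injective := fun i j h => root_injective (PadicInt.ext (by rw [← hφ, ← hφ, h]))
  have hβi (i : Fin 12) : IsIntegral ℤ (β i) :=
    ⟨eval X F, monic_eval_F ℤ, by rw [← aeval_def, aeval_eval_X, hβ]⟩
  have hC : ((eval (eval (5 : ℤ) (H.map fun c => eval 5 (c.map (|·|)))) (G.map (|·|)) : ℤ) : ℝ) <
      (38321 : ℕ) ^ 46 := by exact_mod_cast bound_lt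
  refine eq_zero_of_forall_norm_le hC φ
    (IsAlgClosed.lift (R := ℚ) (M := ℂ) (S := L) : L →ₐ[ℚ] ℂ).toRingHom ?_ (fun σ => ?_) fun σ => ?_
  · have := (eval (eval₂ (⟨β i, hβi i⟩ : integralClosure ℤ L) ⟨β j, hβi j⟩ H) G).2
    rwa [mem_integralClosure_iff, ← Subalgebra.coe_val, ← RingHom.coe_coe, map_eval,
      map_eval₂] at this
  · have hσ (i : Fin 12) : ∃ k, β k = σ (β i) := hβ' _ (by
      rw [← RingHom.coe_coe σ, ← map_eval, hβ, map_zero])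
    obtain ⟨k, hk⟩ := hσ i
    obtain ⟨l, hl⟩ := hσ j
    have hkl : k ≠ l := by
      rintro rfl
      exact hij (hinj (σ.injective (hk.symm.trans hl)))
    rw [← RingHom.coe_coe σ, map_eval, map_eval₂, RingHom.coe_coe, ← hk, ← hl, map_eval, map_eval₂,
      hφ, hφ]
    have := norm_eval_G_root hkl
    rwa [PadicInt.norm_def, coe_eval, coe_eval₂] at this
  · have hroot (x : L) (hx : eval x F = 0) (ψ : L →+* ℂ) : ‖ψ (σ x)‖ ≤ (5 : ℤ) := by
      refine (norm_le_of_eval_F ?_).trans_eq (by norm_num)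
      rw [← map_eval, ← RingHom.coe_coe σ, ← map_eval, hx, map_zero, map_zero]
    rw [← RingHom.coe_coe σ, map_eval, map_eval₂, map_eval, map_eval₂]
    refine (norm_eval_le (norm_eval₂_le (hroot _ (hβ i) _) (hroot _ (hβ j) _) H) G).trans_eq ?_
    simpa using (map_eval _ (Int.castRingHom ℝ) (G.map (|·|))).symm

theorem color_eq_iff [IsGalois ℚ L] {φ : L →+* ℚ_[38321]} {β : Fin 12 → L}
    (hφ : ∀ i, φ (β i) = root i) (hβ : ∀ i, eval (β i) F = 0)
    (hβ' : ∀ x, eval x F = 0 → ∃ i, β i = x) {i j k l : Fin 12} (hij : i ≠ j) (hkl : k ≠ l) :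
    ProjLine.color i j = ProjLine.color k l ↔ eval₂ (β i) (β j) H = eval₂ (β k) (β l) H := by
  have hφ₂ (i j : Fin 12) : φ (eval₂ (β i) (β j) H) = eval₂ (root i) (root j) H := by
    rw [map_eval₂, hφ, hφ, coe_eval₂]
  have hG {i j : Fin 12} (hij : i ≠ j) : eval (eval₂ (root i) (root j) H) G = 0 := by
    refine PadicInt.ext ?_
    rw [coe_eval, ← hφ₂, ← map_eval, eval_G_eq_zero hφ hβ hβ' hij, map_zero, PadicInt.coe_zero]
  constructor
  · intro h
    refine φ.injective ?_
    rw [hφ₂, hφ₂]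
    refine congrArg _ (eq_of_toZMod_eq (hG hij) (hG hkl) ?_ ?_)
    · rw [toZMod_eval₂_root hij, toZMod_eval₂_root hkl, h]
    · rw [toZMod_eval₂_root hkl, ← eq_intCast (Int.castRingHom (ZMod 38321)), ← map_evalDeriv,
        eq_intCast]
      intro h0
      refine evalDeriv_G_ne _ (ProjLine.color_lt k l hkl) (Int.emod_eq_zero_of_dvd ?_)
      exact (ZMod.intCast_zmod_eq_zero_iff_dvd _ 38321).1 h0
  · intro h
    have h' : eval₂ (root i) (root j) H = eval₂ (root k) (root l) H :=
      PadicInt.ext (by rw [← hφ₂, ← hφ₂, h])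
    have := congrArg PadicInt.toZMod h'
    rw [toZMod_eval₂_root hij, toZMod_eval₂_root hkl, ZMod.intCast_eq_intCast_iff'] at this
    exact rootMod_injective _ (ProjLine.color_lt i j hij) _ (ProjLine.color_lt k l hkl) this

end NumberField

end CoeffList

theorem exists_injective_hom_of_forall_smul_eq {G X L : Type*} [Group G] [MulAction G L] {γ : X → L}
    (hγ : γ.Injective) (hG : ∀ g : G, (∀ x, g • γ x = γ x) → g = 1) {P : Subgroup (Equiv.Perm X)}
    (h : ∀ g : G, ∃ π ∈ P, ∀ x, g • γ x = γ (π x)) : ∃ f : G →* P, Function.Injective f := by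
  choose f hf hγf using h
  refine ⟨MonoidHom.mk' (fun g => ⟨f g, hf g⟩) fun g g' => ?_, ?_⟩
  · refine Subtype.ext (Equiv.ext fun x => hγ ?_)
    rw [← hγf, mul_smul, hγf, hγf]
    rfl
  · refine (injective_iff_map_eq_one _).2 fun g hg => hG g fun x => ?_
    have : f g = 1 := congrArg Subtype.val hg
    rw [hγf, this, Equiv.Perm.one_apply]

open ProjLine in
theorem nonempty_mulEquiv_psl {G : Type*} [Group G] [Finite G] (hG : 660 ∣ Nat.card G)
    [Fact (Nat.Prime 11)] {f : G →* (toPerm (ZMod 11)).range} (hf : Function.Injective f) :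
    Nonempty (G ≃* PSL(2, ZMod 11)) ∧ Nat.card G = 660 := by
  have h1 : 660 ≤ Nat.card G := Nat.le_of_dvd Nat.card_pos hG
  have h2 := Nat.card_le_card_of_injective f hf
  have : Fact (2 < 11) := ⟨by norm_num⟩
  have h3 := natCard_range_toPerm_le (ZMod 11) ZMod.neg_one_ne_one
  rw [Nat.card_zmod] at h3
  have h4 : Function.Bijective f :=
    (Nat.bijective_iff_injective_and_card f).2 ⟨hf, by lia⟩
  refine ⟨⟨(MulEquiv.ofBijective f h4).trans ?_⟩, by lia⟩
  exact ((QuotientGroup.quotientMulEquivOfEq (ker_toPerm (ZMod 11)).symm).trans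
    (QuotientGroup.quotientKerEquivRange (toPerm (ZMod 11)))).symm

open ProjLine in
theorem exists_injective_hom {L : Type*} [Field L] [NumberField L] [IsGalois ℚ L]
    [hL : IsSplittingField ℚ L (CoeffList.eval X CoeffList.F)] [Fact (Nat.Prime 11)] :
    ∃ f : (L ≃ₐ[ℚ] L) →* (toPerm (ZMod 11)).range, Function.Injective f := by
  obtain ⟨φ, β, hφ, hβ, hβ'⟩ := CoeffList.exists_roots (L := L)
  have hinj : β.Injective := fun i j h =>
    CoeffList.root_injective (PadicInt.ext (by rw [← hφ, ← hφ, h]))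
  let e : Fin 12 ≃ OnePoint (ZMod 11) := Equiv.ofBijective _
    ((Nat.bijective_iff_injective_and_card _).2 ⟨point_injective, by
      rw [Nat.card_fin, OnePoint, Finite.card_option, Nat.card_zmod]⟩)
  have he (i : Fin 12) : e i = point i := rfl
  refine exists_injective_hom_of_forall_smul_eq (γ := β ∘ e.symm) (hinj.comp e.symm.injective)
    (fun σ hσ => ?_) fun σ => ?_
  · have h : (σ : L →ₐ[ℚ] L) = AlgHom.id ℚ L := by
      refine AlgHom.ext_of_adjoin_eq_top
        (IsSplittingField.adjoin_rootSet L (CoeffList.eval X CoeffList.F : ℚ[X])) fun x hx => ?_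
      rw [mem_rootSet_of_ne (CoeffList.monic_eval_F _).ne_zero, CoeffList.aeval_eval_X] at hx
      obtain ⟨i, rfl⟩ := hβ' x hx
      simpa using hσ (e i)
    exact AlgEquiv.ext fun x => DFunLike.congr_fun h x
  · have hσ (i : Fin 12) : ∃ k, β k = σ (β i) := hβ' _ (by
      rw [← RingHom.coe_coe σ, ← CoeffList.map_eval, hβ, map_zero])
    choose s hs using hσ
    have hsinj : s.Injective := fun i j h =>
      hinj (σ.injective (by rw [← hs, ← hs, h]))
    obtain ⟨a, b, c, d, hdet, hmobius⟩ := exists_mobius hsinj fun i j k l hij hkl h => by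
      rw [CoeffList.color_eq_iff hφ hβ hβ' (hsinj.ne hij) (hsinj.ne hkl), hs, hs, hs, hs,
        ← RingHom.coe_coe σ, ← CoeffList.map_eval₂, ← CoeffList.map_eval₂,
        (CoeffList.color_eq_iff hφ hβ hβ' hij hkl).1 h]
    obtain ⟨M, hM⟩ := exists_toPerm hdet
    refine ⟨_, ⟨M, rfl⟩, fun x => ?_⟩
    obtain ⟨i, rfl⟩ := e.surjective x
    have : toPerm (ZMod 11) M (e i) = e (s i) := by rw [he, hM, he, hmobius]
    rw [this]
    simp [hs]

/-- The Galois group over `ℚ` of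
`x¹² - 2x¹¹ - 9x¹⁰ + 60x⁸ + 42x⁷ + 141x⁶ + 162x⁵ + 150x⁴ + 60x³ + 141x² + 18x + 21`
is isomorphic to `PSL₂(𝔽₁₁)`; in particular it has order `660`. -/
theorem galois_group_isomorphic_to_PSL2_F11 :
    let f : Polynomial ℚ :=
      X ^ 12 - 2 * X ^ 11 - 9 * X ^ 10 + 60 * X ^ 8 + 42 * X ^ 7 + 141 * X ^ 6
        + 162 * X ^ 5 + 150 * X ^ 4 + 60 * X ^ 3 + 141 * X ^ 2 + 18 * X + 21
    Nonempty (f.Gal ≃* Matrix.ProjectiveSpecialLinearGroup (Fin 2) (ZMod 11)) ∧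
      Nat.card f.Gal = 660 := by
  intro f
  have hf : f = CoeffList.eval X CoeffList.F := by
    simp only [f, CoeffList.eval, CoeffList.F]
    push_cast
    ring
  rw [hf]
  have : Fact (Nat.Prime 11) := ⟨by norm_num⟩
  let L := (CoeffList.eval X CoeffList.F : ℚ[X]).SplittingField
  have : IsSplittingField ℚ L (CoeffList.eval X CoeffList.F) :=
    IsSplittingField.splittingField (CoeffList.eval X CoeffList.F : ℚ[X])
  have : NumberField L := {}
  have : Normal ℚ L := Normal.of_isSplittingField (CoeffList.eval X CoeffList.F : ℚ[X])
  have : IsGalois ℚ L := ⟨⟩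
  obtain ⟨φ, hφ⟩ := exists_injective_hom (L := L)
  refine nonempty_mulEquiv_psl (CoeffList.dvd_natCard_gal ?_) hφ
  rw [← CoeffList.map_eval_X (algebraMap ℚ L)]
  exact IsSplittingField.splits L _
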